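/- arXiv:1506.09203 — 12 statements merged into one kernel-verified Lean document; each statement's English description precedes it below -/
import Mathlib

section
/- Let R>0, ε>0 and C≥1, and let F:(0,R)→ℝ be differentiable satisfying: (i) F'(x)<0 for all x∈(0,R); (ii) the doubling property (1/C)|F'(r)| ≤ |F'(x)| ≤ C|F'(r)| whenever r/2 < x < 2r < R; (iii) −x·F'(x) ≥ ε for all x∈(0,R). Then there exists a constant C' ≥ 1 depending only on C and ε such that for all x₁, x₂ ∈ (0,R) with max{ε·x₁, x₁ − 1/|F'(x₁)|} ≤ x₂ ≤ x₁ + 1/|F'(x₁)|, one has (1/C')·|F'(x₁)| ≤ |F'(x₂)| ≤ C'·|F'(x₁)| and (1/C')·f(x₁) ≤ f(x₂) ≤ C'·f(x₁), where f = e^{−F}. -/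
/-- Points at ratio at most `2` have comparable values under the doubling property. -/
lemma doubling_step {C R : ℝ} (hC : 1 ≤ C) {g : ℝ → ℝ}
    (hg : ∀ r x : ℝ, r / 2 < x → x < 2 * r → 2 * r < R →
      |g r| / C ≤ |g x| ∧ |g x| ≤ C * |g r|)
    {x y : ℝ} (hx : 0 < x) (hxy : x ≤ y) (hyR : y < R) (hyx : y ≤ 2 * x) :
    |g y| ≤ C ^ 2 * |g x| ∧ |g x| ≤ C ^ 2 * |g y| := by
  have hC0 : 0 < C := by linarith
  obtain ⟨r, hr₁, hr₂⟩ : ∃ r, y / 2 < r ∧ r < min (R / 2) (2 * x) :=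
    exists_between (lt_min (by linarith) (by linarith))
  have hrR := hr₂.trans_le (min_le_left _ _)
  have hrx := hr₂.trans_le (min_le_right _ _)
  obtain ⟨hx₁, hx₂⟩ := hg r x (by linarith) (by linarith) (by linarith)
  obtain ⟨hy₁, hy₂⟩ := hg r y (by linarith) (by linarith) (by linarith)
  rw [div_le_iff₀ hC0] at hx₁ hy₁
  constructor <;> nlinarith

/-- Points at ratio at most `2 ^ n` have comparable values under the doubling property. -/
lemma doubling_iterate {C R : ℝ} (hC : 1 ≤ C) {g : ℝ → ℝ}
    (hg : ∀ r x : ℝ, r / 2 < x → x < 2 * r → 2 * r < R →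
      |g r| / C ≤ |g x| ∧ |g x| ≤ C * |g r|) (n : ℕ)
    {x y : ℝ} (hx : 0 < x) (hxy : x ≤ y) (hyR : y < R) (hyx : y ≤ 2 ^ n * x) :
    |g y| ≤ (C ^ 2) ^ n * |g x| ∧ |g x| ≤ (C ^ 2) ^ n * |g y| := by
  induction n generalizing y with
  | zero =>
    obtain rfl : x = y := by
      rw [pow_zero, one_mul] at hyx
      exact le_antisymm hxy hyx
    simp
  | succ n ih =>
    have h2 : (1 : ℝ) ≤ 2 ^ n := one_le_pow₀ (by norm_num)
    have hzy : max x (y / 2) ≤ y := max_le hxy (by linarith)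
    have hxz : x ≤ max x (y / 2) := le_max_left _ _
    have hyz : y / 2 ≤ max x (y / 2) := le_max_right _ _
    have hzx : max x (y / 2) ≤ 2 ^ n * x := by
      rw [pow_succ] at hyx
      exact max_le (by nlinarith) (by linarith)
    obtain ⟨h₁, h₂⟩ := ih hxz (hzy.trans_lt hyR) hzx
    obtain ⟨h₃, h₄⟩ := doubling_step hC hg (hx.trans_le hxz) hzy hyR (by linarith)
    constructor
    · calc |g y| ≤ C ^ 2 * |g (max x (y / 2))| := h₃
        _ ≤ C ^ 2 * ((C ^ 2) ^ n * |g x|) := by gcongr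
        _ = (C ^ 2) ^ (n + 1) * |g x| := by ring
    · calc |g x| ≤ (C ^ 2) ^ n * |g (max x (y / 2))| := h₂
        _ ≤ (C ^ 2) ^ n * (C ^ 2 * |g y|) := by gcongr
        _ = (C ^ 2) ^ (n + 1) * |g y| := by ring

theorem derivative_and_f_comparable_at_nearby_points (ε C : ℝ) (hε : 0 < ε) (hC : 1 ≤ C) :
    ∃ C' : ℝ, 1 ≤ C' ∧
      ∀ (R : ℝ), 0 < R → ∀ (F F' : ℝ → ℝ),
        (∀ x ∈ Set.Ioo (0:ℝ) R, HasDerivAt F (F' x) x) →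
        (∀ x ∈ Set.Ioo (0:ℝ) R, F' x < 0) →
        (∀ r x : ℝ, r / 2 < x → x < 2 * r → 2 * r < R →
          |F' r| / C ≤ |F' x| ∧ |F' x| ≤ C * |F' r|) →
        (∀ x ∈ Set.Ioo (0:ℝ) R, ε ≤ -x * F' x) →
        ∀ x₁ ∈ Set.Ioo (0:ℝ) R, ∀ x₂ ∈ Set.Ioo (0:ℝ) R,
          max (ε * x₁) (x₁ - 1 / |F' x₁|) ≤ x₂ → x₂ ≤ x₁ + 1 / |F' x₁| →
          (|F' x₁| / C' ≤ |F' x₂| ∧ |F' x₂| ≤ C' * |F' x₁|) ∧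
          (Real.exp (-F x₁) / C' ≤ Real.exp (-F x₂) ∧
            Real.exp (-F x₂) ≤ C' * Real.exp (-F x₁)) := by
  obtain ⟨n, hn⟩ := pow_unbounded_of_one_lt (1 + 1 / ε) (one_lt_two)
  set M : ℝ := (C ^ 2) ^ n
  have hM1 : 1 ≤ M := one_le_pow₀ (one_le_pow₀ hC)
  have hMexp : M ≤ Real.exp M := by linarith [Real.add_one_le_exp M]
  refine ⟨Real.exp M, hM1.trans hMexp, ?_⟩
  intro R _ F F' hF hneg hdoub hlow x₁ hx₁ x₂ hx₂ hle hge
  have hd : 0 < |F' x₁| := abs_pos.2 (hneg x₁ hx₁).ne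
  have hεx : ε * x₁ ≤ x₂ := (le_max_left _ _).trans hle
  have hsub : x₁ - 1 / |F' x₁| ≤ x₂ := (le_max_right _ _).trans hle
  have hinv : 1 / |F' x₁| ≤ 1 / ε * x₁ := by
    rw [one_div_mul_eq_div, div_le_div_iff₀ hd hε, abs_of_neg (hneg x₁ hx₁)]
    linarith [hlow x₁ hx₁]
  have hup : x₂ ≤ 2 ^ n * x₁ := by nlinarith [hx₁.1]
  have hdown : x₁ ≤ 2 ^ n * x₂ := by
    have : x₁ ≤ 1 / ε * x₂ := by
      rw [one_div_mul_eq_div, le_div_iff₀ hε]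
      linarith
    nlinarith [hx₂.1]
  have hcomp : ∀ z ∈ Set.uIcc x₁ x₂, |F' z| ≤ M * |F' x₁| ∧ |F' x₁| ≤ M * |F' z| := by
    intro z hz
    have h2 : (0 : ℝ) < 2 ^ n := by positivity
    rcases Set.mem_uIcc.1 hz with ⟨h₁, h₂⟩ | ⟨h₂, h₁⟩
    · exact doubling_iterate hC hdoub n hx₁.1 h₁ (h₂.trans_lt hx₂.2) (h₂.trans hup)
    · exact (doubling_iterate hC hdoub n (hx₂.1.trans_le h₂) h₁ hx₁.2
        (hdown.trans (by gcongr))).symm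
  have hmvt : |F x₂ - F x₁| ≤ M * |F' x₁| * |x₂ - x₁| :=
    (convex_uIcc x₁ x₂).norm_image_sub_le_of_norm_hasDerivWithin_le
      (fun z hz => (hF z (Set.OrdConnected.uIcc_subset inferInstance hx₁ hx₂ hz)).hasDerivWithinAt)
      (fun z hz => (hcomp z hz).1) Set.left_mem_uIcc Set.right_mem_uIcc
  have hdist : |F' x₁| * |x₂ - x₁| ≤ 1 := by
    have : |x₂ - x₁| ≤ 1 / |F' x₁| := abs_le.2 ⟨by linarith, by linarith⟩
    rwa [le_div_iff₀' hd] at this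
  have hFM : |F x₂ - F x₁| ≤ M := by nlinarith
  obtain ⟨hF₁, hF₂⟩ := abs_le.1 hFM
  obtain ⟨hc₁, hc₂⟩ := hcomp x₂ Set.right_mem_uIcc
  refine ⟨⟨?_, hc₁.trans (by gcongr)⟩, ?_, ?_⟩
  · rw [div_le_iff₀' (Real.exp_pos M)]
    exact hc₂.trans (by gcongr)
  · rw [← Real.exp_sub, Real.exp_le_exp]
    linarith
  · rw [← Real.exp_add, Real.exp_le_exp]
    linarith
end

section
/- Let x₁ ∈ ℝ and r* > 0, and let f : [x₁, x₁+r*] → ℝ be continuous with 0 < f(u) < f(x₁+r*) for all u ∈ [x₁, x₁+r*). Set λ* = f(x₁+r*), and suppose that the improper integrals h = ∫_{x₁}^{x₁+r*} f(u)²/√(λ*² − f(u)²) du and r = ∫_{x₁}^{x₁+r*} λ*/√(λ*² − f(u)²) du are finite. Then λ*·(r − r*) ≤ h ≤ 2·λ*·(r − r*). -/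
open MeasureTheory

theorem sq_div_sqrt_sub_sq_bounds {a L : ℝ} (ha : 0 < a) (haL : a < L) :
    L * (L / Real.sqrt (L ^ 2 - a ^ 2) - 1) ≤ a ^ 2 / Real.sqrt (L ^ 2 - a ^ 2) ∧
      a ^ 2 / Real.sqrt (L ^ 2 - a ^ 2) ≤ 2 * L * (L / Real.sqrt (L ^ 2 - a ^ 2) - 1) := by
  have hd : 0 < L ^ 2 - a ^ 2 := by nlinarith
  have hs : 0 < Real.sqrt (L ^ 2 - a ^ 2) := Real.sqrt_pos.2 hd
  have hsq := Real.sq_sqrt hd.le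
  set s := Real.sqrt (L ^ 2 - a ^ 2)
  have hsL : s ≤ L := by nlinarith
  have hL : L / s - 1 = (L - s) / s := by field_simp
  rw [hL, ← mul_div_assoc, ← mul_div_assoc]
  constructor
  · gcongr
    nlinarith
  · gcongr
    nlinarith [sq_nonneg (L - s)]

theorem height_comparable_to_horizontal_displacement
    (x₁ rstar : ℝ) (hrstar : 0 < rstar) (f : ℝ → ℝ)
    (hf : ContinuousOn f (Set.Icc x₁ (x₁ + rstar)))
    (hpos : ∀ u ∈ Set.Ico x₁ (x₁ + rstar), 0 < f u ∧ f u < f (x₁ + rstar))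
    (hint1 : IntegrableOn
      (fun u => f u ^ 2 / Real.sqrt (f (x₁ + rstar) ^ 2 - f u ^ 2))
      (Set.Ioo x₁ (x₁ + rstar)))
    (hint2 : IntegrableOn
      (fun u => f (x₁ + rstar) / Real.sqrt (f (x₁ + rstar) ^ 2 - f u ^ 2))
      (Set.Ioo x₁ (x₁ + rstar)))
    (h r : ℝ)
    (hh : h = ∫ u in Set.Ioo x₁ (x₁ + rstar),
      f u ^ 2 / Real.sqrt (f (x₁ + rstar) ^ 2 - f u ^ 2))
    (hr : r = ∫ u in Set.Ioo x₁ (x₁ + rstar),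
      f (x₁ + rstar) / Real.sqrt (f (x₁ + rstar) ^ 2 - f u ^ 2)) :
    f (x₁ + rstar) * (r - rstar) ≤ h ∧ h ≤ 2 * f (x₁ + rstar) * (r - rstar) := by
  have hbounds (u : ℝ) (hu : u ∈ Set.Ioo x₁ (x₁ + rstar)) :=
    sq_div_sqrt_sub_sq_bounds (hpos u ⟨hu.1.le, hu.2⟩).1 (hpos u ⟨hu.1.le, hu.2⟩).2
  have hone : IntegrableOn (fun _ : ℝ => (1 : ℝ)) (Set.Ioo x₁ (x₁ + rstar)) :=
    integrableOn_const measure_Ioo_lt_top.ne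
  have hdiff : r - rstar = ∫ u in Set.Ioo x₁ (x₁ + rstar),
      (f (x₁ + rstar) / Real.sqrt (f (x₁ + rstar) ^ 2 - f u ^ 2) - 1) := by
    rw [integral_sub hint2 hone, ← hr]
    simp [hrstar.le]
  rw [hdiff, hh, ← integral_const_mul, ← integral_const_mul]
  exact ⟨setIntegral_mono_on ((hint2.sub hone).const_mul _) hint1 measurableSet_Ioo
      fun u hu => (hbounds u hu).1,
    setIntegral_mono_on hint1 ((hint2.sub hone).const_mul _) measurableSet_Ioo
      fun u hu => (hbounds u hu).2⟩
end

section
/- Let x₁ ∈ ℝ and r* > 0, and let F : [x₁, x₁+r*] → ℝ be continuously differentiable with F'(u) < 0 for all u, and with |F'| nonincreasing (equivalently, 1/|F'| nondecreasing) on [x₁, x₁+r*]. Set f = e^{−F} and λ* = f(x₁+r*), so that 0 < f(u) < λ* for u ∈ [x₁, x₁+r*). If the improper integral h = ∫_{x₁}^{x₁+r*} f(u)²/√(λ*² − f(u)²) du is finite, then h ≤ (1/|F'(x₁+r*)|)·√(λ*² − f(x₁)²). -/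
open MeasureTheory

theorem height_upper_bound (x₁ rstar : ℝ) (hrstar : 0 < rstar) (F F' : ℝ → ℝ)
    (hderiv : ∀ u ∈ Set.Icc x₁ (x₁ + rstar),
      HasDerivWithinAt F (F' u) (Set.Icc x₁ (x₁ + rstar)) u)
    (hcont : ContinuousOn F' (Set.Icc x₁ (x₁ + rstar)))
    (hneg : ∀ u ∈ Set.Icc x₁ (x₁ + rstar), F' u < 0)
    (hmono : AntitoneOn (fun u => |F' u|) (Set.Icc x₁ (x₁ + rstar)))
    (hint : IntegrableOn
      (fun u => Real.exp (-F u) ^ 2 /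
        Real.sqrt (Real.exp (-F (x₁ + rstar)) ^ 2 - Real.exp (-F u) ^ 2))
      (Set.Ioo x₁ (x₁ + rstar))) :
    (∫ u in Set.Ioo x₁ (x₁ + rstar),
        Real.exp (-F u) ^ 2 /
          Real.sqrt (Real.exp (-F (x₁ + rstar)) ^ 2 - Real.exp (-F u) ^ 2))
      ≤ (1 / |F' (x₁ + rstar)|) *
        Real.sqrt (Real.exp (-F (x₁ + rstar)) ^ 2 - Real.exp (-F x₁) ^ 2) := by
  set b := x₁ + rstar with hb
  have hab : x₁ ≤ b := by linarith
  have hbmem : b ∈ Set.Icc x₁ b := Set.right_mem_Icc.2 hab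
  have hFcont : ContinuousOn F (Set.Icc x₁ b) := fun u hu => (hderiv u hu).continuousWithinAt
  have hanti : StrictAntiOn F (Set.Icc x₁ b) := by
    refine strictAntiOn_of_hasDerivWithinAt_neg (f' := F') (convex_Icc _ _) hFcont ?_ ?_
    · intro u hu
      exact (hderiv u (interior_subset hu)).mono interior_subset
    · intro u hu
      exact hneg u (interior_subset hu)
  have hc : 0 < |F' b| := abs_pos.2 (hneg b hbmem).ne
  rw [← integral_Ioc_eq_integral_Ioo, ← intervalIntegral.integral_of_le hab]
  have key := intervalIntegral.integral_le_sub_of_hasDeriv_right_of_le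
    (g := fun u => -((1 / |F' b|) *
      Real.sqrt (Real.exp (-F b) ^ 2 - Real.exp (-F u) ^ 2)))
    (g' := fun u => (|F' u| / |F' b|) * (Real.exp (-F u) ^ 2 /
      Real.sqrt (Real.exp (-F b) ^ 2 - Real.exp (-F u) ^ 2)))
    hab (by fun_prop) ?_ ((integrableOn_Icc_iff_integrableOn_Ioo).2 hint) ?_
  · simpa using key
  · intro u hu
    have huI := Set.Ioo_subset_Icc_self hu
    have hF : HasDerivAt F (F' u) u := (hderiv u huI).hasDerivAt (Icc_mem_nhds hu.1 hu.2)
    have hpos : 0 < Real.exp (-F b) ^ 2 - Real.exp (-F u) ^ 2 := by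
      have h : Real.exp (-F u) < Real.exp (-F b) :=
        Real.exp_lt_exp.2 (neg_lt_neg (hanti huI hbmem hu.2))
      exact sub_pos.2 (pow_lt_pow_left₀ h (Real.exp_pos _).le two_ne_zero)
    have hd := (((((hF.fun_neg).exp.fun_pow 2).const_sub (Real.exp (-F b) ^ 2)).sqrt
      hpos.ne').const_mul (1 / |F' b|)).fun_neg
    refine HasDerivAt.hasDerivWithinAt (hd.congr_deriv ?_)
    have hs := (Real.sqrt_pos.2 hpos).ne'
    rw [abs_of_neg (hneg u huI)]
    field_simp
    norm_num
    ring
  · intro u hu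
    have h1 : 1 ≤ |F' u| / |F' b| :=
      (one_le_div hc).2 (hmono (Set.Ioo_subset_Icc_self hu) hbmem hu.2.le)
    exact le_mul_of_one_le_left (by positivity) h1
end

section
/- Let R>0, ε>0, C≥1 and let F:(0,R)→ℝ be twice differentiable satisfying: lim_{x→0⁺} F(x) = +∞; F'(x) < 0 and F''(x) > 0 for all x∈(0,R); (1/C)|F'(r)| ≤ |F'(x)| ≤ C|F'(r)| whenever r/2 < x < 2r < R; and −x·F'(x) ≥ ε for all x∈(0,R). Set f = e^{−F}. Then there exist constants c₁, c₂ > 0, depending only on C and ε, such that for all r₀ ∈ (0, R/2): c₁·f(r₀)/F'(r₀)² ≤ ∫₀^{r₀} f(r)/|F'(r)| dr ≤ c₂·f(r₀)/F'(r₀)². (This integral is comparable to the area of the control ball B(0,r₀) for the metric dt² = dx² + f(x)^{−2}dy².) -/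
open MeasureTheory

/-- The fundamental theorem of calculus for `exp (-F)` when its derivative `exp (-F) * (-F')` is
nonnegative; integrability of the derivative is part of the conclusion. -/
lemma integral_exp_neg_mul_neg_deriv {F F' : ℝ → ℝ} {φ : ℝ → ℝ} {a b : ℝ} (hab : a ≤ b)
    (hφ : ContinuousOn φ (Set.Icc a b)) (hφF : ∀ x ∈ Set.Ioi a, φ x = Real.exp (-F x))
    (hF : ∀ x ∈ Set.Ioo a b, HasDerivAt F (F' x) x) (hF' : ∀ x ∈ Set.Ioo a b, F' x ≤ 0) :
    IntegrableOn (fun x => Real.exp (-F x) * (-F' x)) (Set.Ioo a b) ∧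
      ∫ x in Set.Ioo a b, Real.exp (-F x) * (-F' x) = φ b - φ a := by
  have hd : ∀ x ∈ Set.Ioo a b, HasDerivAt φ (Real.exp (-F x) * (-F' x)) x := fun x hx =>
    (hF x hx).neg.exp.congr_of_eventuallyEq
      (Filter.eventuallyEq_of_mem (Ioi_mem_nhds hx.1) hφF)
  have hi := intervalIntegral.integrableOn_deriv_of_nonneg hφ hd fun x hx =>
    mul_nonneg (Real.exp_pos _).le (neg_nonneg.2 (hF' x hx))
  refine ⟨hi.mono_set Set.Ioo_subset_Ioc_self, ?_⟩
  rw [← integral_Ioc_eq_integral_Ioo, ← intervalIntegral.integral_of_le hab]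
  exact intervalIntegral.integral_eq_sub_of_hasDerivAt_of_le hab hφ hd
    ((intervalIntegrable_iff_integrableOn_Ioc_of_le hab).2 hi)

theorem area_of_control_ball (ε C : ℝ) (hε : 0 < ε) (hC : 1 ≤ C) :
    ∃ c₁ c₂ : ℝ, 0 < c₁ ∧ 0 < c₂ ∧
      ∀ (R : ℝ), 0 < R → ∀ (F F' F'' : ℝ → ℝ),
        (∀ x ∈ Set.Ioo (0:ℝ) R, HasDerivAt F (F' x) x) →
        (∀ x ∈ Set.Ioo (0:ℝ) R, HasDerivAt F' (F'' x) x) →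
        Filter.Tendsto F (nhdsWithin 0 (Set.Ioi 0)) Filter.atTop →
        (∀ x ∈ Set.Ioo (0:ℝ) R, F' x < 0) →
        (∀ x ∈ Set.Ioo (0:ℝ) R, 0 < F'' x) →
        (∀ r x : ℝ, r / 2 < x → x < 2 * r → 2 * r < R →
          |F' r| / C ≤ |F' x| ∧ |F' x| ≤ C * |F' r|) →
        (∀ x ∈ Set.Ioo (0:ℝ) R, ε ≤ -x * F' x) →
        ∀ r₀ ∈ Set.Ioo (0:ℝ) (R / 2),
          c₁ * (Real.exp (-F r₀) / (F' r₀) ^ 2) ≤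
            (∫ r in Set.Ioo (0:ℝ) r₀, Real.exp (-F r) / |F' r|) ∧
          (∫ r in Set.Ioo (0:ℝ) r₀, Real.exp (-F r) / |F' r|) ≤
            c₂ * (Real.exp (-F r₀) / (F' r₀) ^ 2) := by
  have hC0 : 0 < C := by linarith
  have he1 : Real.exp (-(ε / 2)) < 1 := by simpa using hε
  refine ⟨(1 - Real.exp (-(ε / 2))) / C ^ 2, 1, div_pos (by linarith) (by positivity), one_pos, ?_⟩
  intro R hR F F' F'' hF hF' hlim hneg hpos hdbl hεx r₀ hr₀
  obtain ⟨h0, h1⟩ := hr₀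
  have hr₀R : r₀ < R := by linarith
  have hmono : StrictMonoOn F' (Set.Ioo 0 R) := by
    refine strictMonoOn_of_deriv_pos (convex_Ioo 0 R)
      (fun x hx => (hF' x hx).continuousAt.continuousWithinAt) fun x hx => ?_
    rw [interior_Ioo] at hx
    rw [(hF' x hx).deriv]
    exact hpos x hx
  have hsub : ∀ x ∈ Set.Ioc 0 r₀, x ∈ Set.Ioo 0 R := fun x hx => ⟨hx.1, by linarith [hx.2]⟩
  have hr : r₀ ∈ Set.Ioo 0 R := ⟨h0, hr₀R⟩
  have hN : F' r₀ < 0 := hneg _ hr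
  have hle : ∀ x ∈ Set.Ioc 0 r₀, F' x ≤ F' r₀ := fun x hx =>
    hmono.monotoneOn (hsub x hx) hr hx.2
  have hcont : ∀ x ∈ Set.Ioo 0 R, ContinuousAt (fun x => Real.exp (-F x)) x := fun x hx =>
    (hF x hx).continuousAt.neg.rexp
  set φ : ℝ → ℝ := fun x => if x ≤ 0 then 0 else Real.exp (-F x) with hφ
  have hφe : ∀ x ∈ Set.Ioi (0:ℝ), φ x = Real.exp (-F x) := fun x hx => by
    simp [hφ, not_le.2 (Set.mem_Ioi.1 hx)]
  have hφc : ContinuousOn φ (Set.Icc 0 r₀) := by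
    intro x hx
    rcases hx.1.eq_or_lt with rfl | hx0
    · have ht : Filter.Tendsto φ (nhdsWithin 0 (Set.Ioi 0)) (nhds (φ 0)) := by
        have h00 : φ 0 = 0 := by simp [hφ]
        rw [h00]
        refine (Real.tendsto_exp_neg_atTop_nhds_zero.comp hlim).congr' ?_
        filter_upwards [self_mem_nhdsWithin] with x hx
        exact (hφe x hx).symm
      have ht' : ContinuousWithinAt φ (Set.Ioi 0) 0 := ht
      exact (continuousWithinAt_Ioi_iff_Ici.1 ht').mono Set.Icc_subset_Ici_self
    · exact ((hcont x (hsub x ⟨hx0, hx.2⟩)).congr_of_eventuallyEq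
        (Filter.eventuallyEq_of_mem (Ioi_mem_nhds hx0) hφe)).continuousWithinAt
  obtain ⟨hI, hIeq⟩ := integral_exp_neg_mul_neg_deriv h0.le hφc hφe
    (fun x hx => hF x (hsub x ⟨hx.1, hx.2.le⟩)) (fun x hx => (hneg x (hsub x ⟨hx.1, hx.2.le⟩)).le)
  have hφ0 : φ 0 = 0 := by simp [hφ]
  rw [hφe r₀ h0, hφ0, sub_zero] at hIeq
  have hbound : ∀ x ∈ Set.Ioo 0 r₀, Real.exp (-F x) / |F' x| ≤
      Real.exp (-F x) * (-F' x) * (1 / F' r₀ ^ 2) := by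
    intro x hx
    have hx' : x ∈ Set.Ioc 0 r₀ := ⟨hx.1, hx.2.le⟩
    have hxn := hneg x (hsub x hx')
    have := hle x hx'
    have he := Real.exp_pos (-F x)
    have hsq : F' r₀ ^ 2 ≤ F' x ^ 2 := by nlinarith
    have h2 : 0 < F' r₀ ^ 2 := sq_pos_of_neg hN
    rw [abs_of_neg hxn, mul_one_div, div_le_div_iff₀ (by linarith) h2]
    nlinarith
  have hint : IntegrableOn (fun x => Real.exp (-F x) / |F' x|) (Set.Ioo 0 r₀) := by
    refine (hI.mul_const (1 / F' r₀ ^ 2)).mono' ?_ ?_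
    · refine ContinuousOn.aestronglyMeasurable (fun x hx => ?_) measurableSet_Ioo
      have hxR := hsub x ⟨hx.1, hx.2.le⟩
      exact ((hcont x hxR).div (hF' x hxR).continuousAt.abs
        (abs_ne_zero.2 (hneg x hxR).ne)).continuousWithinAt
    · refine (ae_restrict_iff' measurableSet_Ioo).2 (.of_forall fun x hx => ?_)
      rw [Real.norm_of_nonneg (by positivity)]
      exact hbound x hx
  constructor
  · have hhalf : r₀ / 2 ∈ Set.Ioc 0 r₀ := ⟨by linarith, by linarith⟩
    have hss : Set.Ioo (r₀ / 2) r₀ ⊆ Set.Ioo 0 r₀ := Set.Ioo_subset_Ioo_left hhalf.1.le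
    obtain ⟨hJ, hJeq⟩ := integral_exp_neg_mul_neg_deriv (F := F) (F' := F')
      (φ := fun x => Real.exp (-F x)) hhalf.2
      (fun x hx => (hcont x (hsub x ⟨hhalf.1.trans_le hx.1, hx.2⟩)).continuousWithinAt)
      (fun _ _ => rfl)
      (fun x hx => hF x (hsub x ⟨hhalf.1.trans hx.1, hx.2.le⟩))
      (fun x hx => (hneg x (hsub x ⟨hhalf.1.trans hx.1, hx.2.le⟩)).le)
    have hgap : F r₀ + ε / 2 ≤ F (r₀ / 2) := by
      obtain ⟨c, hc, hceq⟩ := exists_hasDerivAt_eq_slope F F' (by linarith : r₀ / 2 < r₀)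
        (fun x hx => (hF x (hsub x ⟨hhalf.1.trans_le hx.1, hx.2⟩)).continuousAt.continuousWithinAt)
        (fun x hx => hF x (hsub x ⟨hhalf.1.trans hx.1, hx.2.le⟩))
      have h3 := hle c ⟨hhalf.1.trans hc.1, hc.2.le⟩
      have h4 := hεx r₀ hr
      rw [eq_div_iff (by linarith)] at hceq
      nlinarith
    have hexp : Real.exp (-F (r₀ / 2)) ≤ Real.exp (-(ε / 2)) * Real.exp (-F r₀) := by
      rw [← Real.exp_add]
      exact Real.exp_le_exp.2 (by linarith)
    have hD : 0 < C ^ 2 * F' r₀ ^ 2 := mul_pos (pow_pos hC0 2) (sq_pos_of_neg hN)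
    calc (1 - Real.exp (-(ε / 2))) / C ^ 2 * (Real.exp (-F r₀) / F' r₀ ^ 2)
        = (Real.exp (-F r₀) - Real.exp (-(ε / 2)) * Real.exp (-F r₀)) *
            (1 / (C ^ 2 * F' r₀ ^ 2)) := by field_simp
      _ ≤ (Real.exp (-F r₀) - Real.exp (-F (r₀ / 2))) * (1 / (C ^ 2 * F' r₀ ^ 2)) := by
          gcongr
      _ = ∫ x in Set.Ioo (r₀ / 2) r₀,
            Real.exp (-F x) * (-F' x) * (1 / (C ^ 2 * F' r₀ ^ 2)) := by
          rw [integral_mul_const, hJeq]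
      _ ≤ ∫ x in Set.Ioo (r₀ / 2) r₀, Real.exp (-F x) / |F' x| := by
          refine setIntegral_mono_on (hJ.mul_const _) (hint.mono_set hss) measurableSet_Ioo
            fun x hx => ?_
          have hxn := hneg x (hsub x ⟨(hss hx).1, hx.2.le⟩)
          have h5 := (hdbl r₀ x hx.1 (by linarith [hx.2]) (by linarith)).2
          have h6 : F' x ^ 2 ≤ C ^ 2 * F' r₀ ^ 2 := by
            rw [← mul_pow, sq_le_sq, abs_mul, abs_of_pos hC0]
            exact h5
          rw [abs_of_neg hxn, mul_one_div, div_le_div_iff₀ hD (by linarith)]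
          nlinarith [Real.exp_pos (-F x)]
      _ ≤ ∫ x in Set.Ioo 0 r₀, Real.exp (-F x) / |F' x| :=
          setIntegral_mono_set hint (.of_forall fun x => by positivity) hss.eventuallyLE
  · calc ∫ r in Set.Ioo 0 r₀, Real.exp (-F r) / |F' r|
        ≤ ∫ x in Set.Ioo 0 r₀, Real.exp (-F x) * (-F' x) * (1 / F' r₀ ^ 2) :=
          setIntegral_mono_on hint (hI.mul_const _) measurableSet_Ioo hbound
      _ = 1 * (Real.exp (-F r₀) / F' r₀ ^ 2) := by
          rw [integral_mul_const, hIeq]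
          ring
end

section
/- For every real m ≥ 1 and all s, t ≥ 0 one has ((s+t)^{1/m} + 1)^m ≤ (s^{1/m} + 1)^m + (t^{1/m} + 1)^m, i.e. the function Θ_m(s) = (s^{1/m}+1)^m is subadditive on [0,∞). Consequently, for m > 1 the function Φ_m(t) = exp(((log t)^{1/m} + 1)^m) is submultiplicative on (1,∞): Φ_m(ab) ≤ Φ_m(a)·Φ_m(b) for all a, b > 1. -/
/-- The comparison `x * Θ_m(y) ≤ y * Θ_m(x)` for `x ≤ y`, where `Θ_m(s) = (s^{1/m} + 1)^m`:
the quotient `Θ_m(s) / s` is nonincreasing. -/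
theorem mul_rpow_inv_add_one_rpow_le {m x y : ℝ} (hm : 1 ≤ m) (hx : 0 ≤ x) (hxy : x ≤ y) :
    x * (y ^ (1 / m) + 1) ^ m ≤ y * (x ^ (1 / m) + 1) ^ m := by
  have hm0 : 0 < m := by linarith
  have hy : 0 ≤ y := hx.trans hxy
  have root (z : ℝ) (hz : 0 ≤ z) : (z ^ (1 / m)) ^ m = z := by
    rw [← Real.rpow_mul hz, one_div_mul_cancel hm0.ne', Real.rpow_one]
  have hle : x ^ (1 / m) ≤ y ^ (1 / m) := Real.rpow_le_rpow hx hxy (by positivity)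
  calc x * (y ^ (1 / m) + 1) ^ m = (x ^ (1 / m) * (y ^ (1 / m) + 1)) ^ m := by
        rw [Real.mul_rpow (by positivity) (by positivity), root x hx]
    _ ≤ (y ^ (1 / m) * (x ^ (1 / m) + 1)) ^ m :=
        Real.rpow_le_rpow (by positivity) (by linarith) hm0.le
    _ = y * (x ^ (1 / m) + 1) ^ m := by
        rw [Real.mul_rpow (by positivity) (by positivity), root y hy]

/-- `s ↦ (s^{1/m} + 1)^m` is subadditive on `[0, ∞)`. -/
theorem rpow_inv_add_one_rpow_add_le {m s t : ℝ} (hm : 1 ≤ m) (hs : 0 ≤ s) (ht : 0 ≤ t) :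
    ((s + t) ^ (1 / m) + 1) ^ m ≤ (s ^ (1 / m) + 1) ^ m + (t ^ (1 / m) + 1) ^ m := by
  rcases (add_nonneg hs ht).eq_or_lt with h | h
  · obtain rfl : s = 0 := by linarith
    obtain rfl : t = 0 := by linarith
    rw [add_zero]
    exact le_add_of_nonneg_right (by positivity)
  · refine le_of_mul_le_mul_left ?_ h
    have h₁ := mul_rpow_inv_add_one_rpow_le hm hs (le_add_of_nonneg_right ht)
    have h₂ := mul_rpow_inv_add_one_rpow_le hm ht (le_add_of_nonneg_left hs)
    linarith

theorem theta_subadditive_and_phi_submultiplicative (m : ℝ) (hm : 1 ≤ m) :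
    (∀ s t : ℝ, 0 ≤ s → 0 ≤ t →
      ((s + t) ^ (1/m) + 1) ^ m ≤ (s ^ (1/m) + 1) ^ m + (t ^ (1/m) + 1) ^ m) ∧
    (1 < m → ∀ a b : ℝ, 1 < a → 1 < b →
      Real.exp ((Real.log (a * b) ^ (1/m) + 1) ^ m) ≤
        Real.exp ((Real.log a ^ (1/m) + 1) ^ m) *
          Real.exp ((Real.log b ^ (1/m) + 1) ^ m)) := by
  refine ⟨fun s t hs ht => rpow_inv_add_one_rpow_add_le hm hs ht, fun _ a b ha hb => ?_⟩
  rw [← Real.exp_add, Real.log_mul (by positivity) (by positivity)]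
  exact Real.exp_le_exp.2
    (rpow_inv_add_one_rpow_add_le hm (Real.log_nonneg ha.le) (Real.log_nonneg hb.le))
end

section
/- Let E > 1 and let Φ : (0,∞) → (0,∞) be a function such that t ↦ Φ(t)/t is nondecreasing on (0,∞), Φ(t) = (Φ(E)/E)·t for all 0 < t ≤ E, and Φ(ab) ≤ Φ(a)·Φ(b) for all a, b ≥ E. Then Φ is submultiplicative on all of (0,∞): Φ(ab) ≤ Φ(a)·Φ(b) for all a, b > 0. -/
theorem submultiplicative_linear_extension (E : ℝ) (hE : 1 < E) (Φ : ℝ → ℝ)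
    (hpos : ∀ t : ℝ, 0 < t → 0 < Φ t)
    (hmono : MonotoneOn (fun t => Φ t / t) (Set.Ioi (0:ℝ)))
    (hlin : ∀ t : ℝ, 0 < t → t ≤ E → Φ t = (Φ E / E) * t)
    (hsub : ∀ a b : ℝ, E ≤ a → E ≤ b → Φ (a * b) ≤ Φ a * Φ b) :
    ∀ a b : ℝ, 0 < a → 0 < b → Φ (a * b) ≤ Φ a * Φ b := by
  intro a b ha hb
  have hmax : ∀ t : ℝ, 0 < t → Φ (max t E) / max t E = Φ t / t := by
    intro t ht
    rcases le_total t E with h | h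
    · rw [max_eq_right h, hlin t ht h, mul_div_cancel_right₀ _ ht.ne']
    · rw [max_eq_left h]
  have ha' : 0 < max a E := lt_max_of_lt_left ha
  have hb' : 0 < max b E := lt_max_of_lt_left hb
  have key : Φ (a * b) / (a * b) ≤ Φ a * Φ b / (a * b) :=
    calc Φ (a * b) / (a * b)
        ≤ Φ (max a E * max b E) / (max a E * max b E) :=
          hmono (mul_pos ha hb) (mul_pos ha' hb')
            (mul_le_mul (le_max_left a E) (le_max_left b E) hb.le ha'.le)
      _ ≤ Φ (max a E) * Φ (max b E) / (max a E * max b E) :=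
          div_le_div_of_nonneg_right (hsub _ _ (le_max_right a E) (le_max_right b E))
            (mul_pos ha' hb').le
      _ = Φ a * Φ b / (a * b) := by
          rw [← div_mul_div_comm, hmax a ha, hmax b hb, div_mul_div_comm]
  exact (div_le_div_iff_of_pos_right (mul_pos ha hb)).mp key
end

section
/- The Moser recursion fails at the exponent m = 2: let K > e and B₀ > e^{4}, and define B_{n+1} = Φ₂(K·B_n) = exp(((log(K·B_n))^{1/2} + 1)^2). Then (log B_n)^{1/2} − n → ∞ as n → ∞; in particular, for every constant C* > 1 there exists n with B_n > exp(((log C*)^{1/2} + n)^2), so no constant C* satisfies Φ₂^{(n)}(C*) ≥ B_n for all n. Equivalently, Φ₂^{(−n)}(B_n) = exp(((log B_n)^{1/2} − n)^2) → ∞ as n → ∞. -/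
/-- The recursion `x ↦ √(1 + x²) + 1` moves the barrier `n + log (n + 1) / 4` above its successor. -/
theorem barrier_succ_le (n : ℕ) :
    ((n + 1 : ℕ) : ℝ) + Real.log (((n + 1 : ℕ) : ℝ) + 1) / 4 ≤
      Real.sqrt (1 + ((n : ℝ) + Real.log ((n : ℝ) + 1) / 4) ^ 2) + 1 := by
  have hn : (0 : ℝ) < (n : ℝ) + 1 := by positivity
  have hlog_nonneg : 0 ≤ Real.log ((n : ℝ) + 1) := Real.log_nonneg (by linarith [n.cast_nonneg (α := ℝ)])
  have hlog_le : Real.log ((n : ℝ) + 1) ≤ n := by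
    linarith [Real.log_le_sub_one_of_pos hn]
  have hlog_succ : Real.log ((n : ℝ) + 1 + 1) ≤ Real.log ((n : ℝ) + 1) + 1 / ((n : ℝ) + 1) := by
    have h := Real.log_le_sub_one_of_pos (show 0 < ((n : ℝ) + 1 + 1) / (n + 1) by positivity)
    rw [Real.log_div (by positivity) hn.ne'] at h
    have : ((n : ℝ) + 1 + 1) / (n + 1) - 1 = 1 / ((n : ℝ) + 1) := by field_simp; ring
    linarith
  set y : ℝ := (n : ℝ) + Real.log ((n : ℝ) + 1) / 4 with hy
  set δ : ℝ := 1 / ((n : ℝ) + 1) with hδ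
  have hδ_pos : 0 < δ := by positivity
  have hδ_mul : δ * ((n : ℝ) + 1) = 1 := by rw [hδ]; field_simp
  have hδ_le : δ ≤ 1 := by nlinarith [n.cast_nonneg (α := ℝ)]
  have hsqrt : y + δ / 4 ≤ Real.sqrt (1 + y ^ 2) := by
    apply Real.le_sqrt_of_sq_le
    have hyn : y ≤ 5 / 4 * n := by linarith
    nlinarith [mul_le_mul_of_nonneg_left hyn hδ_pos.le]
  push_cast
  linarith

theorem moser_recursion_fails_for_m_eq_two (K B₀ : ℝ)
    (hK : Real.exp 1 < K) (hB₀ : Real.exp 4 < B₀)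
    (B : ℕ → ℝ) (h0 : B 0 = B₀)
    (hrec : ∀ n : ℕ, B (n + 1) =
      Real.exp ((Real.sqrt (Real.log (K * B n)) + 1) ^ 2)) :
    Filter.Tendsto (fun n : ℕ => Real.sqrt (Real.log (B n)) - (n : ℝ))
      Filter.atTop Filter.atTop ∧
    (∀ Cstar : ℝ, 1 < Cstar → ∃ n : ℕ,
      Real.exp ((Real.sqrt (Real.log Cstar) + (n : ℝ)) ^ 2) < B n) ∧
    Filter.Tendsto (fun n : ℕ => Real.exp ((Real.sqrt (Real.log (B n)) - (n : ℝ)) ^ 2))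
      Filter.atTop Filter.atTop := by
  have hK_pos : 0 < K := (Real.exp_pos 1).trans hK
  have hlogK : 1 < Real.log K := (Real.lt_log_iff_exp_lt hK_pos).2 hK
  have hB_one : ∀ n, 1 < B n := by
    rintro (_ | n)
    · rw [h0]
      exact (Real.one_lt_exp_iff.2 (by norm_num)).trans hB₀
    · rw [hrec]
      exact Real.one_lt_exp_iff.2 (by positivity)
  have hB_pos : ∀ n, 0 < B n := fun n => one_pos.trans (hB_one n)
  have hbarrier : ∀ n : ℕ,
      (n : ℝ) + Real.log ((n : ℝ) + 1) / 4 ≤ Real.sqrt (Real.log (B n)) := by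
    intro n
    induction n with
    | zero => simp
    | succ n ih =>
      refine (barrier_succ_le n).trans ?_
      rw [hrec, Real.log_exp, Real.sqrt_sq (by positivity),
        Real.log_mul hK_pos.ne' (hB_pos n).ne']
      have hnonneg : 0 ≤ (n : ℝ) + Real.log ((n : ℝ) + 1) / 4 := by
        have := Real.log_nonneg (show (1 : ℝ) ≤ (n : ℝ) + 1 by simp)
        positivity
      have hsq := (Real.le_sqrt hnonneg (Real.log_pos (hB_one n)).le).1 ih
      gcongr
  have htend : Filter.Tendsto (fun n : ℕ => Real.sqrt (Real.log (B n)) - (n : ℝ))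
      Filter.atTop Filter.atTop := by
    have hlog : Filter.Tendsto (fun n : ℕ => Real.log ((n : ℝ) + 1) / 4)
        Filter.atTop Filter.atTop :=
      (Real.tendsto_log_atTop.comp (Filter.tendsto_atTop_add_const_right _ 1
        tendsto_natCast_atTop_atTop)).atTop_div_const (by norm_num)
    exact Filter.tendsto_atTop_mono (fun n => by linarith [hbarrier n]) hlog
  refine ⟨htend, fun C _ => ?_, Real.tendsto_exp_atTop.comp
    ((Filter.tendsto_pow_atTop two_ne_zero).comp htend)⟩
  obtain ⟨n, hn⟩ := (htend.eventually_gt_atTop (Real.sqrt (Real.log C))).exists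
  refine ⟨n, (Real.lt_log_iff_exp_lt (hB_pos n)).1 ((Real.lt_sqrt (by positivity)).1 ?_)⟩
  linarith
end

section
/- Let m > 1 and let M be sufficiently large. Set A = exp(((log M)^{1/m} + 1)^m − log M) and Ψ(t) = A·exp(−((log(1/t))^{1/m} + 1)^m) for 0 < t ≤ 1/M. Then for all M₁ > M₂ > M and every δ ∈ (0,1), there exists N = N(M, M₁, M₂, δ) such that for every integer n > N one has δ·Ψ^{(n)}(1/M₂) ≥ Ψ^{(n)}(1/M₁), where Ψ^{(n)} denotes the n-th iterate of Ψ. -/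
/-- The logarithmic conjugate `x ↦ (x ^ (1/m) + 1) ^ m - c` of the bump function. -/
noncomputable def logBump (m c x : ℝ) : ℝ := (x ^ (1 / m) + 1) ^ m - c

/-- A logarithmic Bernoulli inequality. -/
theorem one_add_div_le_one_add_one_div_rpow {p s : ℝ} (hp : 0 ≤ p) (hs : 0 < s) :
    1 + p / (s + 1) ≤ (1 + 1 / s) ^ p := by
  have hpos : 0 < 1 + 1 / s := by positivity
  have hlog : 1 / (s + 1) ≤ Real.log (1 + 1 / s) := by
    have h := Real.one_sub_inv_le_log_of_pos hpos
    have e : 1 - (1 + 1 / s)⁻¹ = 1 / (s + 1) := by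
      field_simp
      ring
    rwa [e] at h
  rw [Real.rpow_def_of_pos hpos]
  have h1 := Real.add_one_le_exp (Real.log (1 + 1 / s) * p)
  have h2 := mul_le_mul_of_nonneg_right hlog hp
  have e : 1 / (s + 1) * p = p / (s + 1) := by ring
  linarith

/-- Shifting by one expands differences of `m`-th powers by a definite factor. -/
theorem mul_rpow_sub_rpow_le_shift {m r s : ℝ} (hm : 1 < m) (hr : 0 ≤ r) (hrs : r ≤ s) :
    (1 + (m - 1) / (s + 1)) * (s ^ m - r ^ m) ≤ (s + 1) ^ m - (r + 1) ^ m := by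
  set κ := 1 + (m - 1) / (s + 1) with hκ
  have hderiv (z : ℝ) : HasDerivAt (fun z : ℝ => (z + 1) ^ m - κ * z ^ m)
      (1 * m * (z + 1) ^ (m - 1) - κ * (m * z ^ (m - 1))) z :=
    (((hasDerivAt_id z).add_const 1).rpow_const (Or.inr hm.le)).sub
      ((Real.hasDerivAt_rpow_const (Or.inr hm.le)).const_mul κ)
  have hmono : MonotoneOn (fun z : ℝ => (z + 1) ^ m - κ * z ^ m) (Set.Icc r s) := by
    refine monotoneOn_of_deriv_nonneg (convex_Icc r s)
      (fun z _ => (hderiv z).continuousAt.continuousWithinAt)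
      (fun z _ => (hderiv z).differentiableAt.differentiableWithinAt) fun z hz => ?_
    rw [interior_Icc] at hz
    have hz0 : 0 < z := hr.trans_lt hz.1
    rw [(hderiv z).deriv]
    have h1 : κ ≤ (1 + 1 / z) ^ (m - 1) :=
      (one_add_div_le_one_add_one_div_rpow (by linarith) (hz0.trans hz.2)).trans
        (Real.rpow_le_rpow (by have := hz0.trans hz.2; positivity)
          (by gcongr; exact hz.2.le) (by linarith))
    have h2 : (1 + 1 / z) ^ (m - 1) * z ^ (m - 1) = (z + 1) ^ (m - 1) := by
      rw [← Real.mul_rpow (by positivity) hz0.le]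
      congr 1
      field_simp
    have h3 := mul_le_mul_of_nonneg_right h1 (Real.rpow_nonneg hz0.le (m - 1))
    rw [h2] at h3
    nlinarith
  have := hmono (Set.left_mem_Icc.2 hrs) (Set.right_mem_Icc.2 hrs) hrs
  simp only at this
  linarith

theorem mul_sub_le_logBump_sub {m c x y : ℝ} (hm : 1 < m) (hy : 0 ≤ y) (hyx : y ≤ x) :
    (1 + (m - 1) / (x ^ (1 / m) + 1)) * (x - y) ≤ logBump m c x - logBump m c y := by
  have hm0 : m ≠ 0 := by positivity
  have h := mul_rpow_sub_rpow_le_shift hm (Real.rpow_nonneg hy (1 / m))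
    (Real.rpow_le_rpow hy hyx (by positivity))
  rw [one_div, Real.rpow_inv_rpow (hy.trans hyx) hm0, Real.rpow_inv_rpow hy hm0] at h
  simp only [logBump, one_div]
  linarith

theorem logBump_mono {m c x y : ℝ} (hm : 1 < m) (hy : 0 ≤ y) (hyx : y ≤ x) :
    logBump m c y ≤ logBump m c x := by
  unfold logBump
  gcongr

/-- In the coordinate `x ^ (1/m)` the map `logBump` moves points by at most one. -/
theorem logBump_rpow_le {m c x : ℝ} (hm : 1 < m) (hc : 0 ≤ c) (hx : 0 ≤ x)
    (hg : 0 ≤ logBump m c x) : logBump m c x ^ (1 / m) ≤ x ^ (1 / m) + 1 := by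
  have hs : 0 ≤ x ^ (1 / m) + 1 := by positivity
  calc logBump m c x ^ (1 / m) ≤ ((x ^ (1 / m) + 1) ^ m) ^ (1 / m) :=
        Real.rpow_le_rpow hg (by unfold logBump; linarith) (by positivity)
    _ = x ^ (1 / m) + 1 := by
        rw [one_div] at hs ⊢
        exact Real.rpow_rpow_inv hs (by positivity)

theorem logBump_iterate_bounds {m c L x y : ℝ} (hm : 1 < m) (hc : 0 ≤ c) (hL : 0 ≤ L)
    (hfix : logBump m c L = L) (hy : L ≤ y) (hyx : y ≤ x) (n : ℕ) :
    L ≤ (logBump m c)^[n] y ∧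
      ((logBump m c)^[n] x) ^ (1 / m) ≤ x ^ (1 / m) + n ∧
      (x - y) + (x - y) * (m - 1) / (x ^ (1 / m) + 1) *
        ∑ i ∈ Finset.range n, 1 / ((i : ℝ) + 1) ≤
          (logBump m c)^[n] x - (logBump m c)^[n] y := by
  have hs0 : 0 ≤ x ^ (1 / m) := Real.rpow_nonneg (by linarith) _
  induction n with
  | zero => simpa using hy
  | succ n ih =>
    obtain ⟨h1, h2, h3⟩ := ih
    rw [Function.iterate_succ_apply', Function.iterate_succ_apply', Finset.sum_range_succ]
    set u := (logBump m c)^[n] x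
    set v := (logBump m c)^[n] y
    set s := x ^ (1 / m)
    have hp : 0 < m - 1 := by linarith
    have hd : 0 ≤ x - y := by linarith
    have hd' : x - y ≤ u - v := by
      have : 0 ≤ (x - y) * (m - 1) / (s + 1) *
          ∑ i ∈ Finset.range n, 1 / ((i : ℝ) + 1) := by positivity
      linarith
    have hv0 : 0 ≤ v := hL.trans h1
    have hvu : v ≤ u := by linarith
    have hgv : L ≤ logBump m c v := by
      simpa only [hfix] using logBump_mono (c := c) hm hL h1
    have hgu : L ≤ logBump m c u := hgv.trans (logBump_mono hm hv0 hvu)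
    refine ⟨hgv, ?_, ?_⟩
    · have := logBump_rpow_le hm hc (hv0.trans hvu) (hL.trans hgu)
      push_cast
      linarith
    · have hexp := mul_sub_le_logBump_sub (c := c) hm hv0 hvu
      have hus : 0 ≤ u ^ (1 / m) := Real.rpow_nonneg (hv0.trans hvu) _
      have hden : u ^ (1 / m) + 1 ≤ (s + 1) * ((n : ℝ) + 1) := by
        nlinarith [mul_nonneg hs0 (Nat.cast_nonneg (α := ℝ) n)]
      have hstep : (x - y) * (m - 1) / (s + 1) * (1 / ((n : ℝ) + 1)) ≤
          (m - 1) / (u ^ (1 / m) + 1) * (u - v) :=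
        calc (x - y) * (m - 1) / (s + 1) * (1 / ((n : ℝ) + 1))
            = (m - 1) / ((s + 1) * ((n : ℝ) + 1)) * (x - y) := by field_simp
          _ ≤ (m - 1) / (u ^ (1 / m) + 1) * (u - v) := by gcongr
      linarith

open Filter in
theorem tendsto_logBump_iterate_sub {m c L x y : ℝ} (hm : 1 < m) (hc : 0 ≤ c) (hL : 0 ≤ L)
    (hfix : logBump m c L = L) (hy : L ≤ y) (hyx : y < x) :
    Tendsto (fun n => (logBump m c)^[n] x - (logBump m c)^[n] y) atTop atTop := by
  have hs0 : 0 ≤ x ^ (1 / m) := Real.rpow_nonneg (by linarith) _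
  have hk : 0 < (x - y) * (m - 1) / (x ^ (1 / m) + 1) :=
    div_pos (mul_pos (by linarith) (by linarith)) (by linarith)
  exact tendsto_atTop_mono
    (fun n => (logBump_iterate_bounds hm hc hL hfix hy hyx.le n).2.2)
    (tendsto_atTop_add_const_left _ _
      (Real.tendsto_sum_range_one_div_nat_succ_atTop.const_mul_atTop hk))

theorem small_value_iterates_absorb_small_constant (m : ℝ) (hm : 1 < m) :
    ∃ M₀ : ℝ, 0 < M₀ ∧ ∀ M : ℝ, M₀ ≤ M →
      ∀ (A : ℝ) (Ψ : ℝ → ℝ),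
        A = Real.exp ((Real.log M ^ (1/m) + 1) ^ m - Real.log M) →
        Ψ = (fun t : ℝ => A * Real.exp (-(Real.log (1/t) ^ (1/m) + 1) ^ m)) →
        ∀ M₁ M₂ δ : ℝ, M < M₂ → M₂ < M₁ → 0 < δ → δ < 1 →
          ∃ N : ℕ, ∀ n : ℕ, N < n →
            Ψ^[n] (1 / M₁) ≤ δ * Ψ^[n] (1 / M₂) := by
  refine ⟨1, one_pos, fun M hM A Ψ hA hΨ M₁ M₂ δ h₂ h₁ hδ _ => ?_⟩
  set L := Real.log M
  set c := (L ^ (1 / m) + 1) ^ m - L with hc_def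
  have hL : 0 ≤ L := Real.log_nonneg hM
  have hc : 0 ≤ c := by
    have h : (L ^ (1 / m)) ^ m ≤ (L ^ (1 / m) + 1) ^ m := by
      gcongr
      linarith
    rw [one_div, Real.rpow_inv_rpow hL (by positivity)] at h
    rw [hc_def, one_div]
    linarith
  have hfix : logBump m c L = L := by simp [logBump, hc_def]
  have hconj : Function.Semiconj (fun x => Real.exp (-x)) (logBump m c) Ψ := by
    intro x
    rw [hΨ, hA]
    simp only [logBump]
    rw [one_div (Real.exp (-x)), ← Real.exp_neg, neg_neg, Real.log_exp, ← Real.exp_add]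
    congr 1
    ring
  have hiter {K : ℝ} (hK : 0 < K) (n : ℕ) :
      Ψ^[n] (1 / K) = Real.exp (-(logBump m c)^[n] (Real.log K)) := by
    have h := hconj.iterate_right n (Real.log K)
    simp only [Real.exp_neg, Real.exp_log hK] at h
    rw [one_div, ← h, Real.exp_neg]
  have hM0 : 0 < M := by linarith
  have hM₂ : 0 < M₂ := by linarith
  obtain ⟨N, hN⟩ := Filter.eventually_atTop.1
    ((tendsto_logBump_iterate_sub hm hc hL hfix (Real.log_le_log hM0 h₂.le)
      (Real.log_lt_log hM₂ h₁)).eventually_ge_atTop (-Real.log δ))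
  refine ⟨N, fun n hn => ?_⟩
  rw [hiter (hM₂.trans h₁), hiter hM₂]
  nth_rewrite 1 [← Real.exp_log hδ]
  rw [← Real.exp_add]
  apply Real.exp_le_exp.2
  linarith [hN n hn.le]
end

section
/- Let (X, μ) be a measure space and let Ω ⊆ X be the disjoint union of two measurable subsets Ω₁ and Ω₂ with 0 < μ(Ω₁), μ(Ω₂) < ∞ and (1/C₁) ≤ μ(Ω₁)/μ(Ω₂) ≤ C₁ for some constant C₁ ≥ 1. Then there exists a constant C depending only on C₁ (one may take C = 4C₁ + 2) such that for every measurable function w : Ω → ℝ: ∫_{Ω×Ω} |w(x) − w(y)| dμ(x)dμ(y) ≤ C·∫_{Ω₁×Ω₂} |w(x) − w(y)| dμ(x)dμ(y), where both sides are allowed to be infinite. -/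
open MeasureTheory

/-- Without any finiteness assumption on `μ`, the integral over a rectangle is either an iterated
integral for every integrand or the product measure vanishes. -/
theorem prod_eq_zero_or_setLIntegral_prod {X : Type*} [MeasurableSpace X] (μ : Measure X) :
    μ.prod μ = 0 ∨ ∀ (f : X × X → ENNReal), Measurable f → ∀ (A B : Set X), MeasurableSet A →
      MeasurableSet B →
      ∫⁻ p in A ×ˢ B, f p ∂(μ.prod μ) = ∫⁻ x in A, ∫⁻ y in B, f (x, y) ∂μ ∂μ := by
  by_cases h : AEMeasurable (fun x : X => μ.map (Prod.mk x)) μ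
  · right
    intro f hf A B hA hB
    rw [← lintegral_indicator (hA.prod hB), Measure.prod,
      Measure.lintegral_bind h (hf.indicator (hA.prod hB)).aemeasurable, ← lintegral_indicator hA]
    congr 1 with x
    rw [lintegral_map (hf.indicator (hA.prod hB)) measurable_prodMk_left]
    by_cases hx : x ∈ A
    · rw [Set.indicator_of_mem hx, ← lintegral_indicator hB]
      congr 1 with y
      by_cases hy : y ∈ B <;> simp [hx, hy]
    · simp [hx]
  · left
    rw [Measure.prod, Measure.bind, Measure.map_of_not_aemeasurable h, Measure.join_zero]

/-- Averaging the triangle inequality over an intermediate point distributed according to `ν`. -/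
theorem measure_univ_mul_lintegral_abs_sub_le {X : Type*} [MeasurableSpace X] (μ ν : Measure X)
    [SFinite μ] [SFinite ν] {w : X → ℝ} (hw : Measurable w) :
    ν Set.univ * ∫⁻ x, ∫⁻ y, ENNReal.ofReal |w x - w y| ∂μ ∂μ ≤
      2 * μ Set.univ * ∫⁻ x, ∫⁻ z, ENNReal.ofReal |w x - w z| ∂ν ∂μ := by
  have hg : Measurable fun p : X × X => ENNReal.ofReal |w p.1 - w p.2| := by fun_prop
  have hinner (ρ : Measure X) [SFinite ρ] :
      Measurable fun x => ∫⁻ y, ENNReal.ofReal |w x - w y| ∂ρ := hg.lintegral_prod_right'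
  calc ν Set.univ * ∫⁻ x, ∫⁻ y, ENNReal.ofReal |w x - w y| ∂μ ∂μ
      = ∫⁻ x, ∫⁻ y, ∫⁻ _, ENNReal.ofReal |w x - w y| ∂ν ∂μ ∂μ := by
        rw [← lintegral_const_mul _ (hinner μ)]
        congr 1 with x
        rw [← lintegral_const_mul _ (by fun_prop)]
        congr 1 with y
        rw [lintegral_const, mul_comm]
    _ ≤ ∫⁻ x, ∫⁻ y, ∫⁻ z, (ENNReal.ofReal |w x - w z| + ENNReal.ofReal |w y - w z|)
          ∂ν ∂μ ∂μ := by
        refine lintegral_mono fun x => lintegral_mono fun y => lintegral_mono fun z => ?_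
        rw [← ENNReal.ofReal_add (abs_nonneg _) (abs_nonneg _), abs_sub_comm (w y)]
        exact ENNReal.ofReal_le_ofReal (abs_sub_le _ _ _)
    _ = ∫⁻ x, ((∫⁻ z, ENNReal.ofReal |w x - w z| ∂ν) * μ Set.univ +
          ∫⁻ y, ∫⁻ z, ENNReal.ofReal |w y - w z| ∂ν ∂μ) ∂μ := by
        congr 1 with x
        rw [← lintegral_const, ← lintegral_add_left measurable_const]
        congr 1 with y
        rw [lintegral_add_left (by fun_prop)]
    _ = 2 * μ Set.univ * ∫⁻ x, ∫⁻ z, ENNReal.ofReal |w x - w z| ∂ν ∂μ := by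
        rw [lintegral_add_right _ measurable_const, lintegral_const,
          lintegral_mul_const _ (hinner ν)]
        ring

theorem lintegral_abs_sub_le_of_measure_univ_le {X : Type*} [MeasurableSpace X] (μ ν : Measure X)
    [SFinite μ] [IsFiniteMeasure ν] (hν : ν Set.univ ≠ 0) {K : ENNReal}
    (h : μ Set.univ ≤ K * ν Set.univ) {w : X → ℝ} (hw : Measurable w) :
    ∫⁻ x, ∫⁻ y, ENNReal.ofReal |w x - w y| ∂μ ∂μ ≤
      2 * K * ∫⁻ x, ∫⁻ z, ENNReal.ofReal |w x - w z| ∂ν ∂μ := by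
  rw [← ENNReal.mul_le_mul_iff_right hν (measure_ne_top ν _)]
  refine (measure_univ_mul_lintegral_abs_sub_le μ ν hw).trans ?_
  calc _ ≤ 2 * (K * ν Set.univ) * ∫⁻ x, ∫⁻ z, ENNReal.ofReal |w x - w z| ∂ν ∂μ := by gcongr
    _ = _ := by ring

theorem division_of_regions (X : Type*) [MeasurableSpace X] (μ : Measure X)
    (Ω Ω₁ Ω₂ : Set X) (C₁ : ℝ) (hC₁ : 1 ≤ C₁)
    (hm1 : MeasurableSet Ω₁) (hm2 : MeasurableSet Ω₂)
    (hdisj : Disjoint Ω₁ Ω₂) (hunion : Ω = Ω₁ ∪ Ω₂)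
    (h1pos : 0 < μ Ω₁) (h1fin : μ Ω₁ < ⊤)
    (h2pos : 0 < μ Ω₂) (h2fin : μ Ω₂ < ⊤)
    (hratio1 : (μ Ω₁).toReal / (μ Ω₂).toReal ≤ C₁)
    (hratio2 : 1 / C₁ ≤ (μ Ω₁).toReal / (μ Ω₂).toReal)
    (w : X → ℝ) (hw : Measurable w) :
    (∫⁻ p in Ω ×ˢ Ω, ENNReal.ofReal |w p.1 - w p.2| ∂(μ.prod μ)) ≤
      ENNReal.ofReal (4 * C₁ + 2) *
        ∫⁻ p in Ω₁ ×ˢ Ω₂, ENNReal.ofReal |w p.1 - w p.2| ∂(μ.prod μ) := by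
  rcases prod_eq_zero_or_setLIntegral_prod μ with h0 | hprod
  · simp [h0]
  have hg : Measurable fun p : X × X => ENNReal.ofReal |w p.1 - w p.2| := by fun_prop
  have hC₁pos : 0 < C₁ := by linarith
  have hb : 0 < (μ Ω₂).toReal := ENNReal.toReal_pos h2pos.ne' h2fin.ne
  have h12 : μ Ω₁ ≤ ENNReal.ofReal C₁ * μ Ω₂ := by
    rw [← ENNReal.ofReal_toReal h1fin.ne, ← ENNReal.ofReal_toReal h2fin.ne,
      ← ENNReal.ofReal_mul hC₁pos.le]
    exact ENNReal.ofReal_le_ofReal ((div_le_iff₀ hb).1 hratio1)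
  have h21 : μ Ω₂ ≤ ENNReal.ofReal C₁ * μ Ω₁ := by
    rw [← ENNReal.ofReal_toReal h1fin.ne, ← ENNReal.ofReal_toReal h2fin.ne,
      ← ENNReal.ofReal_mul hC₁pos.le]
    refine ENNReal.ofReal_le_ofReal ?_
    rw [div_le_div_iff₀ hC₁pos hb] at hratio2
    linarith
  have : IsFiniteMeasure (μ.restrict Ω₁) := ⟨by simpa using h1fin⟩
  have : IsFiniteMeasure (μ.restrict Ω₂) := ⟨by simpa using h2fin⟩
  have hinner (A : Set X) [IsFiniteMeasure (μ.restrict A)] :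
      Measurable fun x => ∫⁻ y in A, ENNReal.ofReal |w x - w y| ∂μ := hg.lintegral_prod_right'
  have hswap : ∫⁻ x in Ω₂, ∫⁻ y in Ω₁, ENNReal.ofReal |w x - w y| ∂μ ∂μ =
      ∫⁻ x in Ω₁, ∫⁻ y in Ω₂, ENNReal.ofReal |w x - w y| ∂μ ∂μ := by
    rw [lintegral_lintegral_swap hg.aemeasurable]
    simp only [abs_sub_comm]
  have h11 := lintegral_abs_sub_le_of_measure_univ_le (μ.restrict Ω₁) (μ.restrict Ω₂)
    (by simpa using h2pos.ne') (by simpa using h12) hw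
  have h22 := lintegral_abs_sub_le_of_measure_univ_le (μ.restrict Ω₂) (μ.restrict Ω₁)
    (by simpa using h1pos.ne') (by simpa using h21) hw
  have hC : ENNReal.ofReal (4 * C₁ + 2) = 4 * ENNReal.ofReal C₁ + 2 := by
    rw [ENNReal.ofReal_add (by positivity) (by norm_num), ENNReal.ofReal_mul (by norm_num)]
    norm_num
  have hmΩ : MeasurableSet Ω := hunion ▸ hm1.union hm2
  rw [hprod _ hg Ω Ω hmΩ hmΩ, hprod _ hg Ω₁ Ω₂ hm1 hm2, hC, hunion,
    lintegral_union hm2 hdisj]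
  simp only [lintegral_union hm2 hdisj]
  rw [lintegral_add_left (hinner Ω₁), lintegral_add_left (hinner Ω₁), hswap]
  rw [hswap] at h22
  refine (add_le_add (add_le_add_left h11 _) (add_le_add_right h22 _)).trans_eq ?_
  ring
end

section
/- Suppose Φ : [0,1] → [0,1] is increasing, convex, satisfies Φ(0) = 0 and Φ(1) = 1, is submultiplicative (Φ(xy) ≤ Φ(x)·Φ(y) for all x, y ∈ [0,1]), and is asymptotically closer to the identity near 0 than any power, in the sense that there exist no constants γ > 1, c > 0 and t₀ > 0 with Φ(t) ≤ c·t^γ for all t ∈ (0, t₀). Then Φ(t) = t for all t ∈ [0,1]. -/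
theorem submultiplicative_near_identity_is_identity (Φ : ℝ → ℝ)
    (hmap : Set.MapsTo Φ (Set.Icc 0 1) (Set.Icc 0 1))
    (hmono : MonotoneOn Φ (Set.Icc 0 1))
    (hconv : ConvexOn ℝ (Set.Icc 0 1) Φ)
    (h0 : Φ 0 = 0) (h1 : Φ 1 = 1)
    (hsub : ∀ x ∈ Set.Icc (0:ℝ) 1, ∀ y ∈ Set.Icc (0:ℝ) 1, Φ (x * y) ≤ Φ x * Φ y)
    (hnear : ¬ ∃ γ c t₀ : ℝ, 1 < γ ∧ 0 < c ∧ 0 < t₀ ∧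
      ∀ t ∈ Set.Ioo (0:ℝ) t₀, Φ t ≤ c * t ^ γ) :
    ∀ t ∈ Set.Icc (0:ℝ) 1, Φ t = t := by
  intro s hs
  have hle : Φ s ≤ s := by
    have h := hconv.2 (Set.left_mem_Icc.2 zero_le_one) (Set.right_mem_Icc.2 zero_le_one)
      (sub_nonneg.2 hs.2) hs.1 (by ring)
    simpa [h0, h1] using h
  by_contra hne
  have hlt : Φ s < s := lt_of_le_of_ne hle hne
  have hs0 : 0 < s := (hmap hs).1.trans_lt hlt
  have hs1 : s < 1 := lt_of_le_of_ne hs.2 (by rintro rfl; exact hne h1)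
  obtain ⟨γ, hγ, hΦγ⟩ : ∃ γ : ℝ, 1 < γ ∧ Φ s ≤ s ^ γ := by
    have hp0 : 0 < max (Φ s) (s ^ 2) := lt_max_of_lt_right (by positivity)
    have hps : max (Φ s) (s ^ 2) < s := max_lt hlt (by nlinarith)
    refine ⟨Real.logb s (max (Φ s) (s ^ 2)), ?_, ?_⟩
    · rwa [← Real.rpow_lt_rpow_left_iff_of_base_lt_one hs0 hs1, Real.rpow_logb hs0 hs1.ne hp0,
        Real.rpow_one]
    · rw [Real.rpow_logb hs0 hs1.ne hp0]
      exact le_max_left _ _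
  have hpow_mem (n : ℕ) : s ^ n ∈ Set.Icc (0 : ℝ) 1 := ⟨by positivity, pow_le_one₀ hs0.le hs.2⟩
  have hpow (n : ℕ) : Φ (s ^ n) ≤ (s ^ γ) ^ n := by
    induction n with
    | zero => simp [h1]
    | succ n ih =>
      rw [pow_succ, pow_succ]
      exact (hsub _ (hpow_mem n) _ hs).trans
        (mul_le_mul ih hΦγ (hmap hs).1 (by positivity))
  refine hnear ⟨γ, (s ^ γ)⁻¹, 1, hγ, by positivity, one_pos, fun t ht => ?_⟩
  obtain ⟨n, hnt, htn⟩ := exists_nat_pow_near_of_lt_one ht.1 ht.2.le hs0 hs1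
  calc Φ t ≤ Φ (s ^ n) := hmono ⟨ht.1.le, ht.2.le⟩ (hpow_mem n) htn
    _ ≤ (s ^ γ) ^ n := hpow n
    _ = (s ^ γ)⁻¹ * (s ^ (n + 1)) ^ γ := by
      rw [← Real.rpow_pow_comm hs0.le, pow_succ]
      have : s ^ γ ≠ 0 := by positivity
      field_simp
    _ ≤ (s ^ γ)⁻¹ * t ^ γ := by gcongr
end

section
/- Let b ≥ 1 and suppose Φ : [0,1] → [0,1] is increasing, convex, satisfies Φ(0) = 0 and Φ(1) = 1, is b-submultiplicative (Φ(xy) ≤ b·Φ(x)·Φ(y) for all x, y ∈ [0,1]), and is asymptotically closer to the identity near 0 than any power, in the sense that there exist no constants γ > 1, c > 0 and t₀ > 0 with Φ(t) ≤ c·t^γ for all t ∈ (0, t₀). Then Φ is comparable to the identity: there exists a constant c₀ > 0 such that c₀·t ≤ Φ(t) ≤ t for all t ∈ [0,1]. -/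
/-- A submultiplicative-type bound at a single point `s` propagates to all powers of `s`. -/
theorem apply_pow_le_pow_of_submultiplicative {b s q : ℝ} {Φ : ℝ → ℝ}
    (hmap : Set.MapsTo Φ (Set.Icc 0 1) (Set.Icc 0 1))
    (hsub : ∀ x ∈ Set.Icc (0:ℝ) 1, ∀ y ∈ Set.Icc (0:ℝ) 1, Φ (x * y) ≤ b * (Φ x * Φ y))
    (hs0 : 0 ≤ s) (hs1 : s ≤ 1) (hq0 : 0 ≤ q) (hq : b * Φ s ≤ q) (n : ℕ) :
    Φ (s ^ n) ≤ q ^ n := by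
  induction n with
  | zero => simpa using (hmap (Set.right_mem_Icc.2 zero_le_one)).2
  | succ n ih =>
    have hn : s ^ n ∈ Set.Icc (0:ℝ) 1 := ⟨pow_nonneg hs0 n, pow_le_one₀ hs0 hs1⟩
    calc Φ (s ^ (n + 1)) ≤ b * (Φ (s ^ n) * Φ s) := by
          rw [pow_succ]; exact hsub _ hn _ ⟨hs0, hs1⟩
      _ = Φ (s ^ n) * (b * Φ s) := by ring
      _ ≤ Φ (s ^ n) * q := mul_le_mul_of_nonneg_left hq (hmap hn).1
      _ ≤ q ^ n * q := mul_le_mul_of_nonneg_right ih hq0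
      _ = q ^ (n + 1) := (pow_succ q n).symm

/-- A monotone function bounded by `(s ^ γ) ^ n` at `s ^ n` is dominated by the power `t ^ γ`. -/
theorem le_mul_rpow_of_apply_pow_le {s γ t : ℝ} {Φ : ℝ → ℝ}
    (hmono : MonotoneOn Φ (Set.Icc 0 1)) (hs0 : 0 < s) (hs1 : s < 1) (hγ : 0 ≤ γ)
    (hpow : ∀ n : ℕ, Φ (s ^ n) ≤ (s ^ γ) ^ n) (ht0 : 0 < t) (ht1 : t ≤ 1) :
    Φ t ≤ (s ^ γ)⁻¹ * t ^ γ := by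
  obtain ⟨n, hn, hn'⟩ := exists_nat_pow_near_of_lt_one ht0 ht1 hs0 hs1
  have hsγ : 0 < s ^ γ := Real.rpow_pos_of_pos hs0 γ
  calc Φ t ≤ Φ (s ^ n) :=
        hmono ⟨ht0.le, ht1⟩ ⟨by positivity, pow_le_one₀ hs0.le hs1.le⟩ hn'
    _ ≤ (s ^ γ) ^ n := hpow n
    _ = (s ^ γ)⁻¹ * (s ^ γ) ^ (n + 1) := by field_simp; ring
    _ = (s ^ γ)⁻¹ * (s ^ (n + 1)) ^ γ := by rw [Real.rpow_pow_comm hs0.le]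
    _ ≤ (s ^ γ)⁻¹ * t ^ γ := by gcongr


theorem b_submultiplicative_near_identity_is_comparable_to_identity
    (b : ℝ) (hb : 1 ≤ b) (Φ : ℝ → ℝ)
    (hmap : Set.MapsTo Φ (Set.Icc 0 1) (Set.Icc 0 1))
    (hmono : MonotoneOn Φ (Set.Icc 0 1))
    (hconv : ConvexOn ℝ (Set.Icc 0 1) Φ)
    (h0 : Φ 0 = 0) (h1 : Φ 1 = 1)
    (hsub : ∀ x ∈ Set.Icc (0:ℝ) 1, ∀ y ∈ Set.Icc (0:ℝ) 1,
      Φ (x * y) ≤ b * (Φ x * Φ y))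
    (hnear : ¬ ∃ γ c t₀ : ℝ, 1 < γ ∧ 0 < c ∧ 0 < t₀ ∧
      ∀ t ∈ Set.Ioo (0:ℝ) t₀, Φ t ≤ c * t ^ γ) :
    ∃ c₀ : ℝ, 0 < c₀ ∧ ∀ t ∈ Set.Icc (0:ℝ) 1, c₀ * t ≤ Φ t ∧ Φ t ≤ t := by
  have hb0 : 0 < b := zero_lt_one.trans_le hb
  refine ⟨b⁻¹, inv_pos.2 hb0, fun t ht => ⟨?_, ?_⟩⟩
  · by_contra! hlt
    have hlt' : b * Φ t < t := by
      rwa [inv_mul_eq_div, lt_div_iff₀' hb0] at hlt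
    have hΦ : 0 ≤ b * Φ t := mul_nonneg hb0.le (hmap ht).1
    have ht0 : 0 < t := hΦ.trans_lt hlt'
    have ht1 : t < 1 := by
      refine lt_of_le_of_ne ht.2 fun h => ?_
      rw [h, h1] at hlt'
      linarith
    obtain ⟨q, hq, hqt⟩ := exists_between hlt'
    have hq0 : 0 < q := hΦ.trans_lt hq
    have hpow : t ^ Real.logb t q = q := Real.rpow_logb ht0 ht1.ne hq0
    have hγ : 1 < Real.logb t q := by
      rw [← Real.rpow_lt_rpow_left_iff_of_base_lt_one ht0 ht1, hpow, Real.rpow_one]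
      exact hqt
    refine hnear ⟨Real.logb t q, (t ^ Real.logb t q)⁻¹, 1, hγ, by positivity, zero_lt_one,
      fun x hx => le_mul_rpow_of_apply_pow_le hmono ht0 ht1 (by linarith) (fun n => ?_)
        hx.1 hx.2.le⟩
    rw [hpow]
    exact apply_pow_le_pow_of_submultiplicative hmap hsub ht.1 ht.2 hq0.le hq.le n
  · have h := hconv.2 (Set.right_mem_Icc.2 zero_le_one) (Set.left_mem_Icc.2 zero_le_one)
      ht.1 (sub_nonneg.2 ht.2) (add_sub_cancel t 1)
    simpa [h0, h1] using h
end

section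
/- Let δ₀ > 0 and C ≥ 1, and let g : [−1,1] → [0,∞) be a measurable function with g(x) ≤ C·e^{−δ₀/|x|} for all x ≠ 0. Then there exist constants C₂ > 0 and η₀ > 0 such that for every real η with |η| ≥ η₀, the least Rayleigh quotient of the Schrödinger operator −d²/dx² + η²·g(x) with Dirichlet conditions on (−1,1) satisfies λ₀(η) := inf { (∫_{−1}^{1} (f'(x)² + η²·g(x)·f(x)²) dx) / (∫_{−1}^{1} f(x)² dx) : f ∈ C_c^∞((−1,1)), f ≢ 0 } ≤ C₂·(log|η|)². -/
open MeasureTheory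

/-- The numerator of the Rayleigh quotient of a function supported in `[-r, r]`, when the potential
is bounded by `K` on `[-r, r] \ {0}`. -/
lemma setIntegral_rayleigh_numerator_le {V f : ℝ → ℝ} {r K : ℝ}
    (hV0 : ∀ x ∈ Set.Ioo (-1 : ℝ) 1, 0 ≤ V x)
    (hK : ∀ x ∈ Set.Ioo (-1 : ℝ) 1, x ≠ 0 → |x| ≤ r → V x ≤ K)
    (hf : ∀ x, r < |x| → f x = 0)
    (hf_int : Integrable fun x => f x ^ 2) (hdf_int : Integrable fun x => deriv f x ^ 2)
    (hK0 : 0 ≤ K) :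
    ∫ x in Set.Ioo (-1 : ℝ) 1, (deriv f x ^ 2 + V x * f x ^ 2) ≤
      (∫ x, deriv f x ^ 2) + K * ∫ x, f x ^ 2 := by
  have hint : Integrable fun x => deriv f x ^ 2 + K * f x ^ 2 :=
    hdf_int.add (hf_int.const_mul K)
  calc
    _ ≤ ∫ x in Set.Ioo (-1 : ℝ) 1, (deriv f x ^ 2 + K * f x ^ 2) := by
      refine integral_mono_of_nonneg ?_ hint.integrableOn ?_
      · filter_upwards [ae_restrict_mem measurableSet_Ioo] with x hx
        have := hV0 x hx
        positivity
      · filter_upwards [ae_restrict_mem measurableSet_Ioo,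
          ae_restrict_of_ae (Measure.ae_ne volume (0 : ℝ))] with x hx hx0
        rcases le_or_gt |x| r with h | h
        · gcongr
          exact hK x hx hx0 h
        · simp [hf x h]
    _ ≤ ∫ x, (deriv f x ^ 2 + K * f x ^ 2) :=
      setIntegral_le_integral hint (Filter.Eventually.of_forall fun x => by positivity)
    _ = _ := by
      rw [integral_add hdf_int (hf_int.const_mul K), integral_const_mul]

/-- Dilations of a fixed bump function have Dirichlet quotient of order `r⁻²`. -/
lemma exists_contDiff_tsupport_subset_dirichlet_le :
    ∃ K : ℝ, 0 ≤ K ∧ ∀ r : ℝ, 0 < r → ∃ f : ℝ → ℝ, ContDiff ℝ (⊤ : ℕ∞) f ∧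
      tsupport f ⊆ Set.Icc (-(r / 2)) (r / 2) ∧ f 0 = 1 ∧
      (Integrable fun x => f x ^ 2) ∧ (Integrable fun x => deriv f x ^ 2) ∧
      0 < ∫ x, f x ^ 2 ∧ ∫ x, deriv f x ^ 2 = K * r⁻¹ ^ 2 * ∫ x, f x ^ 2 := by
  obtain ⟨φ, hφ_tsupp, hφc, hφ, -, hφ0⟩ := exists_contDiff_tsupport_subset (n := (⊤ : ℕ∞))
    (Ioo_mem_nhds (by norm_num : (-(1 / 2) : ℝ) < 0) (by norm_num : (0 : ℝ) < 1 / 2))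
  have hφ_out : ∀ x : ℝ, 1 / 2 ≤ |x| → φ x = 0 := fun x hx =>
    image_eq_zero_of_notMem_tsupport fun h => hx.not_gt (abs_lt.2 (hφ_tsupp h))
  have hφ_cont : Continuous φ := hφ.continuous
  have hdφ_cont : Continuous (deriv φ) := hφ.continuous_deriv (by simp)
  have hdφc : HasCompactSupport (deriv φ) := hφc.deriv
  have hA_supp : HasCompactSupport fun x => deriv φ x ^ 2 :=
    hdφc.comp_left (g := fun y : ℝ => y ^ 2) (by simp)
  have hA_int : Integrable fun x => deriv φ x ^ 2 :=
    (hdφ_cont.pow 2).integrable_of_hasCompactSupport hA_supp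
  have hB_supp : HasCompactSupport fun x => φ x ^ 2 :=
    hφc.comp_left (g := fun y : ℝ => y ^ 2) (by simp)
  have hB_int : Integrable fun x => φ x ^ 2 :=
    (hφ_cont.pow 2).integrable_of_hasCompactSupport hB_supp
  set A := ∫ x, deriv φ x ^ 2
  set B := ∫ x, φ x ^ 2
  have hA0 : 0 ≤ A := integral_nonneg fun x => by positivity
  have hB0 : 0 < B := (hφ_cont.pow 2).integral_pos_of_hasCompactSupport_nonneg_nonzero
    hB_supp (fun x => by positivity) (x := 0) (by simp [hφ0])
  refine ⟨A / B, by positivity, fun r hr0 => ?_⟩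
  let f : ℝ → ℝ := fun x => φ (x / r)
  have hf_out : ∀ x, r / 2 ≤ |x| → f x = 0 := fun x hx => hφ_out _ <| by
    rw [abs_div, abs_of_pos hr0, le_div_iff₀ hr0]; linarith
  have hdf : ∀ x, deriv f x = r⁻¹ * deriv φ (x / r) := fun x => by
    have h := (hφ.differentiable (by simp)).differentiableAt.hasDerivAt (x := x / r)
    have h2 := h.comp x ((hasDerivAt_id x).div_const r)
    have h3 : deriv f x = deriv φ (x / r) * (1 / r) := h2.deriv
    rw [h3]; ring
  have hf_tsupp : tsupport f ⊆ Set.Icc (-(r / 2)) (r / 2) := by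
    refine closure_minimal (fun x hx => ?_) isClosed_Icc
    by_contra hx'
    refine hx (hf_out x ?_)
    by_contra! h
    exact hx' (abs_le.1 h.le)
  have hf_int : Integrable fun x => f x ^ 2 := hB_int.comp_div hr0.ne'
  have hdf_eq : (fun x => deriv f x ^ 2) = fun x => r⁻¹ ^ 2 * deriv φ (x / r) ^ 2 := by
    funext x
    rw [hdf, mul_pow]
  have hdf_int : Integrable fun x => deriv f x ^ 2 := by
    rw [hdf_eq]
    exact (hA_int.comp_div hr0.ne').const_mul _
  have hf_integral : ∫ x, f x ^ 2 = r * B := by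
    rw [Measure.integral_comp_div (fun y => φ y ^ 2) r, abs_of_pos hr0, smul_eq_mul]
  have hdf_integral : ∫ x, deriv f x ^ 2 = r⁻¹ ^ 2 * (r * A) := by
    rw [hdf_eq, integral_const_mul, Measure.integral_comp_div (fun y => deriv φ y ^ 2) r,
      abs_of_pos hr0, smul_eq_mul]
  refine ⟨f, hφ.comp (contDiff_id.div_const r), hf_tsupp, by simp [f, hφ0], hf_int, hdf_int, ?_, ?_⟩
  · rw [hf_integral]
    positivity
  · rw [hf_integral, hdf_integral]
    field_simp

theorem schrodinger_least_eigenvalue_log_bound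
    (δ₀ C : ℝ) (hδ₀ : 0 < δ₀) (hC : 1 ≤ C) (g : ℝ → ℝ)
    (hmeas : Measurable g)
    (hg0 : ∀ x ∈ Set.Icc (-1:ℝ) 1, 0 ≤ g x)
    (hgbound : ∀ x ∈ Set.Icc (-1:ℝ) 1, x ≠ 0 → g x ≤ C * Real.exp (-δ₀ / |x|)) :
    ∃ C₂ η₀ : ℝ, 0 < C₂ ∧ 0 < η₀ ∧ ∀ η : ℝ, η₀ ≤ |η| →
      sInf { q : ℝ | ∃ f : ℝ → ℝ, ContDiff ℝ (⊤ : ℕ∞) f ∧ HasCompactSupport f ∧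
          tsupport f ⊆ Set.Ioo (-1:ℝ) 1 ∧ f ≠ 0 ∧
          q = (∫ x in Set.Ioo (-1:ℝ) 1,
                ((deriv f x) ^ 2 + η ^ 2 * g x * (f x) ^ 2)) /
              (∫ x in Set.Ioo (-1:ℝ) 1, (f x) ^ 2) }
        ≤ C₂ * Real.log |η| ^ 2 := by
  obtain ⟨K, hK0, hK⟩ := exists_contDiff_tsupport_subset_dirichlet_le
  refine ⟨K / δ₀ ^ 2 * 4 + C, Real.exp (max 1 δ₀), by positivity, by positivity, ?_⟩
  intro η hη
  have hη0 : 0 < |η| := (Real.exp_pos _).trans_le hη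
  set L := Real.log |η| with hL
  have hLmax : max 1 δ₀ ≤ L := (Real.le_log_iff_exp_le hη0).2 hη
  have hL1 : 1 ≤ L := (le_max_left _ _).trans hLmax
  have hLδ : δ₀ ≤ L := (le_max_right _ _).trans hLmax
  have hL0 : 0 < L := by linarith
  have hexp : η ^ 2 * Real.exp (-(2 * L)) = 1 := by
    have : η ^ 2 = Real.exp (2 * L) := by
      rw [two_mul, Real.exp_add, hL, Real.exp_log hη0, ← sq, sq_abs]
    rw [this, ← Real.exp_add]
    simp
  set r := δ₀ / (2 * L) with hr
  have hr0 : 0 < r := by positivity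
  have hr1 : r ≤ 1 := by rw [hr, div_le_one (by positivity)]; linarith
  obtain ⟨f, hf, hf_tsupp, hf0, hf_int, hdf_int, hpos, hdf_integral⟩ := hK r hr0
  have hf_out : ∀ x, r / 2 < |x| → f x = 0 := fun x hx =>
    image_eq_zero_of_notMem_tsupport fun h => hx.not_ge (abs_le.2 (hf_tsupp h))
  have hden : ∫ x in Set.Ioo (-1 : ℝ) 1, f x ^ 2 = ∫ x, f x ^ 2 := by
    refine setIntegral_eq_integral_of_forall_compl_eq_zero fun x hx => ?_
    rw [hf_out x, zero_pow two_ne_zero]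
    by_contra! h
    exact hx (abs_lt.1 (by linarith))
  have hnum := setIntegral_rayleigh_numerator_le (V := fun x => η ^ 2 * g x) (f := f) (r := r)
    (K := C) (fun x hx => mul_nonneg (sq_nonneg η) (hg0 x (Set.Ioo_subset_Icc_self hx)))
    (fun x hx hx0 hxr => by
      have hle : -δ₀ / |x| ≤ -(2 * L) := by
        have hx_pos : 0 < |x| := abs_pos.2 hx0
        rw [hr, le_div_iff₀ (by positivity)] at hxr
        rw [div_le_iff₀ hx_pos]
        linarith
      calc η ^ 2 * g x ≤ η ^ 2 * (C * Real.exp (-(2 * L))) := by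
            gcongr
            exact (hgbound x (Set.Ioo_subset_Icc_self hx) hx0).trans (by gcongr)
        _ = C * (η ^ 2 * Real.exp (-(2 * L))) := by ring
        _ = C := by rw [hexp, mul_one])
    (fun x hx => hf_out x (by linarith)) hf_int hdf_int (by linarith)
  rw [hdf_integral] at hnum
  refine csInf_le_of_le ⟨0, ?_⟩ ⟨f, hf,
    isCompact_Icc.of_isClosed_subset (isClosed_tsupport f) hf_tsupp,
    hf_tsupp.trans (Set.Icc_subset_Ioo (by linarith) (by linarith)), ?_, rfl⟩ ?_
  · rintro q ⟨u, -, -, -, -, rfl⟩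
    refine div_nonneg (setIntegral_nonneg measurableSet_Ioo fun x hx => ?_)
      (integral_nonneg fun x => by positivity)
    have := hg0 x (Set.Ioo_subset_Icc_self hx)
    positivity
  · intro h
    have := congrFun h 0
    simp [hf0] at this
  · rw [hden]
    calc _ ≤ (K * r⁻¹ ^ 2 * (∫ x, f x ^ 2) + C * ∫ x, f x ^ 2) / ∫ x, f x ^ 2 := by gcongr
      _ = K / δ₀ ^ 2 * 4 * L ^ 2 + C := by
        rw [← add_mul, mul_div_cancel_right₀ _ hpos.ne', hr]
        field_simp
        ring
      _ ≤ K / δ₀ ^ 2 * 4 * L ^ 2 + C * L ^ 2 := by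
        gcongr
        exact le_mul_of_one_le_right (by linarith) (one_le_pow₀ hL1)
      _ = _ := by ring
end
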